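/- Let n = 4m with m ≥ 2, P = {0, 1, …, n}, Σ = { {i, j} | 0 ≤ i < j ≤ n } with loc({i, j}) = {i, j}. For 0 ≤ r < m, let a_r be the word {4r,4r+1}{4r+1,4r+2}{4r+2,4r+4} and b_r the word {4r,4r+1}{4r,4r+3}{4r+3,4r+4}, and let S_n = { {4r, n} | 0 ≤ r < m }. Let L_n be the set of traces [w] with w ∈ (a_0 + b_0)(a_1 + b_1)⋯(a_{m−1} + b_{m−1})·S_n. Then L_n is n-fair, and every locally-rejecting finite asynchronous automaton B over (Σ, loc) with L_t(B) = L_n has at least 2^{n/4} local states for process n. -/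

import Mathlib

variable {α P : Type*}

/-- One swap of two adjacent independent letters. -/
def SwapAdj [DecidableEq P] (loc : α → Finset P) (w w' : List α) : Prop :=
  ∃ (u v : List α) (a b : α), loc a ∩ loc b = ∅ ∧
    w = u ++ a :: b :: v ∧ w' = u ++ b :: a :: v

/-- Trace equivalence: finitely many swaps of adjacent independent letters. -/
def TraceEquiv [DecidableEq P] (loc : α → Finset P) : List α → List α → Prop :=
  Relation.ReflTransGen (SwapAdj loc)

/-- The set of processes participating in a word. -/
def locWord [DecidableEq P] (loc : α → Finset P) (w : List α) : Finset P :=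
  w.foldr (fun a s => loc a ∪ s) ∅

/-- The trace of `w` is `k`-fair: every factor of length at least `k` of every
linearisation involves all processes. -/
def IsFairTrace [DecidableEq P] [Fintype P] (loc : α → Finset P) (k : ℕ)
    (w : List α) : Prop :=
  ∀ w' u v x, TraceEquiv loc w w' → w' = u ++ v ++ x → k ≤ v.length →
    locWord loc v = Finset.univ

/-- Helper (on the reversed word) computing the view of a set of processes:
scanning from the right, keep an event iff its location meets the set of
processes already known to be causally after it. -/
def viewRev [DecidableEq P] (loc : α → Finset P) : Finset P → List α → List α
  | _, [] => []
  | T, a :: w =>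
    if (loc a ∩ T).Nonempty then a :: viewRev loc (T ∪ loc a) w
    else viewRev loc T w

/-- The view of a set `X` of processes in the trace of `w`, as a linearisation. -/
def viewWord [DecidableEq P] (loc : α → Finset P) (X : Finset P) (w : List α) : List α :=
  (viewRev loc X w.reverse).reverse

/-- Asynchronous automaton over a distributed alphabet `(α, loc)`: the
transition for letter `a` only reads and writes the components of processes
in `loc a`. -/
structure AsyncAut (α : Type*) {P : Type*} (loc : α → Finset P) (Q : P → Type*) where
  init : ∀ p, Q p
  trans : α → (∀ p, Q p) → (∀ p, Q p)
  final : Set (∀ p, Q p)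
  trans_untouched : ∀ a s p, p ∉ loc a → trans a s p = s p
  trans_local : ∀ a s s', (∀ p ∈ loc a, s p = s' p) →
    ∀ p ∈ loc a, trans a s p = trans a s' p

/-- The global state reached from the initial state when reading `w`
in the semantics of the asynchronous automaton. -/
def AsyncAut.run {loc : α → Finset P} {Q : P → Type*}
    (B : AsyncAut α loc Q) (w : List α) : ∀ p, Q p :=
  w.foldl (fun s a => B.trans a s) B.init

/-- The word language accepted by the asynchronous automaton. -/
def AsyncAut.lang {loc : α → Finset P} {Q : P → Type*}
    (B : AsyncAut α loc Q) : Set (List α) :=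
  {w | B.run w ∈ B.final}

/-- The set of traces of words of `L`, represented by all their linearisations;
two languages have the same set of traces iff their `traceClosure`s coincide. -/
def traceClosure [DecidableEq P] (loc : α → Finset P) (L : Set (List α)) :
    Set (List α) :=
  {w' | ∃ w ∈ L, TraceEquiv loc w w'}

/-- Prefixes (ideals) of the traces of `L`: `u` represents an ideal of a trace
of `L` iff some `w ∈ L` is equivalent to `u ++ v` for some `v`. -/
def prefSet [DecidableEq P] (loc : α → Finset P) (L : Set (List α)) :
    Set (List α) :=
  { u | ∃ v w, w ∈ L ∧ TraceEquiv loc w (u ++ v) }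

/-- A locally-rejecting asynchronous automaton: for each process `p` there is a
set `R p` of local reject states such that, after any trace, the view of `p` is
not a prefix of the accepted trace language iff the local state of `p` is in `R p`. -/
def AsyncAut.LocallyRejecting [DecidableEq P] {loc : α → Finset P} {Q : P → Type*}
    (B : AsyncAut α loc Q) : Prop :=
  ∀ p : P, ∃ R : Set (Q p), ∀ w : List α,
    viewWord loc {p} w ∉ prefSet loc B.lang ↔ B.run w p ∈ R

/-- The alphabet of unordered pairs of distinct processes among `{0, …, 4m}`. -/
abbrev PairL (m : ℕ) := {s : Finset (Fin (4 * m + 1)) // s.card = 2}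

/-- The location map of the pair alphabet: `loc {i,j} = {i,j}`. -/
abbrev pairLoc (m : ℕ) : PairL m → Finset (Fin (4 * m + 1)) := Subtype.val

/-- The letter `{i, j}` for `i ≠ j`. -/
def mkPair (m i j : ℕ) (hi : i < 4 * m + 1) (hj : j < 4 * m + 1) (hij : i ≠ j) :
    PairL m :=
  ⟨{⟨i, hi⟩, ⟨j, hj⟩}, Finset.card_pair (by simp only [ne_eq, Fin.mk.injEq]; omega)⟩

/-- The word `a_r = {4r,4r+1}{4r+1,4r+2}{4r+2,4r+4}`. -/
def aWord (m r : ℕ) (hr : r < m) : List (PairL m) :=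
  [mkPair m (4 * r) (4 * r + 1) (by omega) (by omega) (by omega),
   mkPair m (4 * r + 1) (4 * r + 2) (by omega) (by omega) (by omega),
   mkPair m (4 * r + 2) (4 * r + 4) (by omega) (by omega) (by omega)]

/-- The word `b_r = {4r,4r+1}{4r,4r+3}{4r+3,4r+4}`. -/
def bWord (m r : ℕ) (hr : r < m) : List (PairL m) :=
  [mkPair m (4 * r) (4 * r + 1) (by omega) (by omega) (by omega),
   mkPair m (4 * r) (4 * r + 3) (by omega) (by omega) (by omega),
   mkPair m (4 * r + 3) (4 * r + 4) (by omega) (by omega) (by omega)]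

/-- The language `L_n = (a_0 + b_0)(a_1 + b_1)⋯(a_{m−1} + b_{m−1})·S_n`
with `n = 4m`, where `S_n = { {4r, n} | 0 ≤ r < m }`. -/
def LnSet (m : ℕ) : Set (List (PairL m)) :=
  { w | ∃ (c : Fin m → Bool) (r : Fin m),
      w = (((List.finRange m).map
              (fun r' => if c r' then aWord m r' r'.isLt else bWord m r' r'.isLt)).flatten)
          ++ [mkPair m (4 * (r : ℕ)) (4 * m) (by have := r.isLt; omega) (by omega)
                (by have := r.isLt; omega)] }

theorem traceEquiv_length' {α P : Type*} [DecidableEq P] {loc : α → Finset P} {w w' : List α}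
    (h : TraceEquiv loc w w') : w.length = w'.length := by
  induction h with
  | refl => rfl
  | tail _ h ih =>
    obtain ⟨u, v, a, b, _, h1, h2⟩ := h
    rw [ih, h1, h2]; simp

def blk (m : ℕ) (c : Fin m → Bool) (r : Fin m) : List (PairL m) :=
  if c r then aWord m r r.isLt else bWord m r r.isLt

def blks (m : ℕ) (c : Fin m → Bool) (l : List (Fin m)) : List (PairL m) :=
  (l.map (blk m c)).flatten

def zL (m : ℕ) (r : Fin m) : PairL m :=
  mkPair m (4 * (r : ℕ)) (4 * m) (by have := r.isLt; omega) (by omega)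
                (by have := r.isLt; omega)

theorem mem_LnSet' (m : ℕ) (w) : w ∈ LnSet m ↔ ∃ c r, w = blks m c (List.finRange m) ++ [zL m r] :=
  Iff.rfl

theorem blk_length (m c r) : (blk m c r).length = 3 := by
  unfold blk; split <;> rfl

theorem blks_length (m c l) : (blks m c l).length = 3 * l.length := by
  induction l with
  | nil => rfl
  | cons a l ih =>
    have : blks m c (a :: l) = blk m c a ++ blks m c l := rfl
    rw [this, List.length_append, ih, blk_length, List.length_cons]; ring

theorem mem_mkPair (m i j hi hj hij) (p : Fin (4 * m + 1)) :
    p ∈ pairLoc m (mkPair m i j hi hj hij) ↔ p.val = i ∨ p.val = j := by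
  simp [mkPair, pairLoc, Fin.ext_iff]

theorem blk_touch (m c r) (a) (ha : a ∈ blk m c r) (p) (hp : p ∈ pairLoc m a) :
    4 * r.val ≤ p.val := by
  unfold blk at ha
  split at ha
  all_goals
    simp only [aWord, bWord, List.mem_cons, List.not_mem_nil, or_false] at ha
    rcases ha with rfl | rfl | rfl <;> rw [mem_mkPair] at hp <;> omega

theorem viewRev_cons_mem (m : ℕ) (T : Finset (Fin (4 * m + 1))) (i j hi hj hij) (w)
    (h : (⟨i, hi⟩ : Fin (4 * m + 1)) ∈ T ∨ (⟨j, hj⟩ : Fin (4 * m + 1)) ∈ T) :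
    viewRev (pairLoc m) T (mkPair m i j hi hj hij :: w) = mkPair m i j hi hj hij ::
      viewRev (pairLoc m) (T ∪ pairLoc m (mkPair m i j hi hj hij)) w := by
  rw [viewRev, if_pos]
  rcases h with h | h
  · exact ⟨_, Finset.mem_inter.2 ⟨(mem_mkPair ..).2 (Or.inl rfl), h⟩⟩
  · exact ⟨_, Finset.mem_inter.2 ⟨(mem_mkPair ..).2 (Or.inr rfl), h⟩⟩

theorem viewRev_blk (m c) (r : Fin m) (T : Finset (Fin (4 * m + 1)))
    (hT : (⟨4 * (r.val + 1), by omega⟩ : Fin (4 * m + 1)) ∈ T) (w) :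
    ∃ T' : Finset (Fin (4 * m + 1)), (⟨4 * r.val, by omega⟩ : Fin (4 * m + 1)) ∈ T' ∧
      viewRev (pairLoc m) T ((blk m c r).reverse ++ w) =
        (blk m c r).reverse ++ viewRev (pairLoc m) T' w := by
  unfold blk
  split
  · have hr := r.isLt
    refine ⟨T ∪ pairLoc m (mkPair m (4 * r + 2) (4 * r + 4) (by omega) (by omega) (by omega)) ∪ pairLoc m (mkPair m (4 * r + 1) (4 * r + 2) (by omega) (by omega) (by omega)) ∪ pairLoc m (mkPair m (4 * r) (4 * r + 1) (by omega) (by omega) (by omega)), ?_, ?_⟩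
    rotate_left
    · simp only [aWord, List.reverse_cons, List.reverse_nil, List.nil_append, List.cons_append]
      rw [viewRev_cons_mem, viewRev_cons_mem, viewRev_cons_mem]
      · right; simp only [Finset.mem_union, mem_mkPair]; simp
      · right; simp only [Finset.mem_union, mem_mkPair]; simp
      · right; exact hT
    · simp only [Finset.mem_union, mem_mkPair]; simp
  · have hr := r.isLt
    refine ⟨T ∪ pairLoc m (mkPair m (4 * r + 3) (4 * r + 4) (by omega) (by omega) (by omega)) ∪ pairLoc m (mkPair m (4 * r) (4 * r + 3) (by omega) (by omega) (by omega)) ∪ pairLoc m (mkPair m (4 * r) (4 * r + 1) (by omega) (by omega) (by omega)), ?_, ?_⟩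
    rotate_left
    · simp only [bWord, List.reverse_cons, List.reverse_nil, List.nil_append, List.cons_append]
      rw [viewRev_cons_mem, viewRev_cons_mem, viewRev_cons_mem]
      · left; simp only [Finset.mem_union, mem_mkPair]; simp
      · right; simp only [Finset.mem_union, mem_mkPair]; simp
      · right; exact hT
    · simp only [Finset.mem_union, mem_mkPair]; simp

theorem viewRev_blks (m c) (k : ℕ) (hk : k ≤ m) (T : Finset (Fin (4 * m + 1)))
    (hT : (⟨4 * k, by omega⟩ : Fin (4 * m + 1)) ∈ T) :
    viewRev (pairLoc m) T (blks m c ((List.finRange m).take k)).reverse =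
      (blks m c ((List.finRange m).take k)).reverse := by
  induction k generalizing T with
  | zero => simp [blks, viewRev]
  | succ k ih =>
    have e : blks m c ((List.finRange m).take (k+1)) =
        blks m c ((List.finRange m).take k) ++ blk m c ⟨k, hk⟩ := by
      rw [List.take_succ_eq_append_getElem (by simpa using hk)]
      simp [blks]
    rw [e, List.reverse_append]
    obtain ⟨T', h1, h2⟩ := viewRev_blk m c ⟨k, hk⟩ T hT
      (blks m c ((List.finRange m).take k)).reverse
    rw [h2, ih (by omega) T' h1]

theorem viewRev_full (m c) (T : Finset (Fin (4 * m + 1)))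
    (hT : (⟨4 * m, by omega⟩ : Fin (4 * m + 1)) ∈ T) :
    viewRev (pairLoc m) T (blks m c (List.finRange m)).reverse =
      (blks m c (List.finRange m)).reverse := by
  have := viewRev_blks m c m le_rfl T hT
  rwa [List.take_of_length_le (by simp)] at this

theorem foldl_untouched {α P : Type*} {loc : α → Finset P} {Q : P → Type*}
    (B : AsyncAut α loc Q) (p : P) (w : List α) (h : ∀ a ∈ w, p ∉ loc a) (s) :
    w.foldl (fun s a => B.trans a s) s p = s p := by
  induction w generalizing s with
  | nil => rfl
  | cons a w ih =>
    rw [List.foldl_cons, ih (fun b hb => h b (by simp [hb])),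
      B.trans_untouched _ _ _ (h a (by simp))]

theorem run_append_untouched {α P : Type*} {loc : α → Finset P} {Q : P → Type*}
    (B : AsyncAut α loc Q) (p : P) (u w : List α) (h : ∀ a ∈ w, p ∉ loc a) :
    B.run (u ++ w) p = B.run u p := by
  unfold AsyncAut.run
  rw [List.foldl_append, foldl_untouched B p w h]

theorem run_snoc {α P : Type*} {loc : α → Finset P} {Q : P → Type*}
    (B : AsyncAut α loc Q) (u : List α) (a : α) :
    B.run (u ++ [a]) = B.trans a (B.run u) := by
  simp [AsyncAut.run]

theorem key_step (m : ℕ) (Q : Fin (4 * m + 1) → Type)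
    (B : AsyncAut (PairL m) (pairLoc m) Q) (hB : B.LocallyRejecting)
    (hL : traceClosure (pairLoc m) B.lang = traceClosure (pairLoc m) (LnSet m))
    (c c' : Fin m → Bool) (r : Fin m) (hc : c r = true) (hc' : c' r = false)
    (hlt : ∀ r' < r, c r' = c' r')
    (heq : B.run (blks m c (List.finRange m)) ⟨4 * m, by omega⟩ =
      B.run (blks m c' (List.finRange m)) ⟨4 * m, by omega⟩) : False := by
  have hr := r.isLt
  obtain ⟨s, t, hst⟩ := List.append_of_mem (List.mem_finRange r)
  have hp : (s ++ r :: t).Pairwise (· < ·) := hst ▸ List.pairwise_lt_finRange m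
  rw [List.pairwise_append, List.pairwise_cons] at hp
  obtain ⟨-, ⟨ht, -⟩, hs⟩ := hp
  let Y : PairL m := mkPair m (4 * r) (4 * r + 3) (by omega) (by omega) (by omega)
  let X : PairL m := mkPair m (4 * r) (4 * r + 1) (by omega) (by omega) (by omega)
  let U := blks m c s
  have hU : blks m c' s = U := by
    show (s.map _).flatten = (s.map _).flatten
    congr 1
    apply List.map_congr_left
    intro a ha
    unfold blk
    rw [hlt a (hs a ha r (by simp))]
  have e1 : blks m c (List.finRange m) = (U ++ [X]) ++
      ((aWord m r hr).tail ++ blks m c t) := by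
    rw [hst]; simp [blks, U, blk, hc, aWord, X]
  have e2 : blks m c' (List.finRange m) = ((U ++ [X]) ++ [Y]) ++
      ((bWord m r hr).tail.tail ++ blks m c' t) := by
    rw [hst, ← hU]; simp [blks, blk, hc', bWord, X, Y]
  have ht' : ∀ d, ∀ a ∈ blks m d t, ∀ p ∈ pairLoc m a, 4 * r.val + 4 ≤ p.val := by
    intro d a ha p hp
    simp only [blks, List.mem_flatten, List.mem_map] at ha
    obtain ⟨_, ⟨r', hr', rfl⟩, ha⟩ := ha
    have := blk_touch m d r' a ha p hp
    have := ht r' hr'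
    rw [Fin.lt_def] at this
    omega
  have q1 : ∀ p ∈ pairLoc m Y, B.run (blks m c (List.finRange m)) p = B.run (U ++ [X]) p := by
    intro p hp
    rw [mem_mkPair] at hp
    rw [e1]
    apply run_append_untouched
    intro a ha hpa
    rcases List.mem_append.1 ha with ha | ha
    · simp only [aWord, List.tail_cons, List.mem_cons, List.not_mem_nil, or_false] at ha
      rcases ha with rfl | rfl <;> rw [mem_mkPair] at hpa <;> omega
    · have := ht' _ a ha p hpa
      omega
  have q2 : ∀ p : Fin (4 * m + 1), p.val = 4 * r.val →
      B.run (blks m c' (List.finRange m)) p = B.run (U ++ [X] ++ [Y]) p := by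
    intro p hp
    rw [e2]
    apply run_append_untouched
    intro a ha hpa
    rcases List.mem_append.1 ha with ha | ha
    · simp only [bWord, List.tail_cons, List.mem_cons, List.not_mem_nil, or_false] at ha
      rcases ha with rfl <;> rw [mem_mkPair] at hpa <;> omega
    · have := ht' _ a ha p hpa
      omega
  have key : B.run (blks m c (List.finRange m) ++ [Y] ++ [zL m r]) ⟨4 * m, by omega⟩ =
      B.run (blks m c' (List.finRange m) ++ [zL m r]) ⟨4 * m, by omega⟩ := by
    rw [run_snoc B _ (zL m r), run_snoc B _ (zL m r)]
    apply B.trans_local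
    · intro p hp
      have hp' := (mem_mkPair ..).1 hp
      rcases hp' with h | h
      · rw [q2 p h, run_snoc, run_snoc B _ Y]
        exact B.trans_local Y _ _ q1 p ((mem_mkPair ..).2 (Or.inl h))
      · have : p = ⟨4 * m, by omega⟩ := Fin.ext h
        rw [this, ← heq]
        apply run_append_untouched
        intro a ha hpa
        rw [List.mem_singleton] at ha
        subst ha
        rw [mem_mkPair] at hpa
        simp only at hpa
        omega
    · exact (mem_mkPair ..).2 (Or.inr rfl)
  obtain ⟨R, hR⟩ := hB ⟨4 * m, by omega⟩
  have v1 : viewWord (pairLoc m) {⟨4 * m, by omega⟩} (blks m c' (List.finRange m) ++ [zL m r])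
      = blks m c' (List.finRange m) ++ [zL m r] := by
    unfold viewWord
    rw [List.reverse_append, List.reverse_singleton, List.singleton_append, zL,
      viewRev_cons_mem, viewRev_full]
    · simp
    · simp
    · simp
  have v2 : viewWord (pairLoc m) {⟨4 * m, by omega⟩}
      (blks m c (List.finRange m) ++ [Y] ++ [zL m r])
      = blks m c (List.finRange m) ++ [Y] ++ [zL m r] := by
    unfold viewWord
    rw [List.reverse_append, List.reverse_append, List.reverse_singleton, List.reverse_singleton,
      List.singleton_append, List.singleton_append, zL,
      viewRev_cons_mem, viewRev_cons_mem, viewRev_full]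
    · simp [Y]
    · simp
    · left; simp only [Finset.mem_union, mem_mkPair]; simp
    · simp
  have h1 := hR (blks m c' (List.finRange m) ++ [zL m r])
  have h2 := hR (blks m c (List.finRange m) ++ [Y] ++ [zL m r])
  rw [key, ← h1, v1, v2] at h2
  apply h2.1
  · rintro ⟨v, w, hw, hwe⟩
    have : w ∈ traceClosure (pairLoc m) (LnSet m) := hL ▸ ⟨w, hw, Relation.ReflTransGen.refl⟩
    obtain ⟨w0, hw0, hw0e⟩ := this
    obtain ⟨d, r0, rfl⟩ := (mem_LnSet' m _).1 hw0
    have l1 := traceEquiv_length' hw0e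
    have l2 := traceEquiv_length' hwe
    simp [blks_length] at l1 l2
    omega
  · have : blks m c' (List.finRange m) ++ [zL m r] ∈ traceClosure (pairLoc m) B.lang := by
      rw [hL]
      exact ⟨_, (mem_LnSet' m _).2 ⟨c', r, rfl⟩, Relation.ReflTransGen.refl⟩
    obtain ⟨w, hw, hwe⟩ := this
    exact ⟨[], w, hw, by simpa using hwe⟩

/-- (Lower bound.) For `n = 4m`, `m ≥ 2`: the language `L_n`
is `n`-fair, and every locally-rejecting finite asynchronous automaton whose
trace language is `L_n` has at least `2^(n/4) = 2^m` local states for the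
process `n`. -/
theorem lnSet_fair_and_lower_bound (m : ℕ) (hm : 2 ≤ m) :
    (∀ w ∈ LnSet m, IsFairTrace (pairLoc m) (4 * m) w) ∧
    (∀ (Q : Fin (4 * m + 1) → Type) (inst : ∀ p, Fintype (Q p))
        (B : AsyncAut (PairL m) (pairLoc m) Q),
        B.LocallyRejecting →
        traceClosure (pairLoc m) B.lang = traceClosure (pairLoc m) (LnSet m) →
        2 ^ m ≤ @Fintype.card (Q ⟨4 * m, by omega⟩) (inst ⟨4 * m, by omega⟩)) := by
  constructor
  · intro w hw w' u v x he hw' hv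
    exfalso
    obtain ⟨c, r, rfl⟩ := (mem_LnSet' m _).1 hw
    have l1 := traceEquiv_length' he
    subst hw'
    simp [blks_length] at l1
    omega
  · intro Q inst B hB hL
    let _ := inst
    have := Fintype.card_le_of_injective (α := Fin m → Bool)
      (fun c => B.run (blks m c (List.finRange m)) ⟨4 * m, by omega⟩) ?_
    · simpa using this
    · intro c c' heq
      by_contra hne
      have hne' : {r | c r ≠ c' r}.Nonempty := Function.ne_iff.1 hne
      obtain ⟨r, hr, hmin⟩ := wellFounded_lt.has_min _ hne'
      have hlt : ∀ r' < r, c r' = c' r' := by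
        intro r' h
        by_contra h'
        exact hmin r' h' h
      have hr' : c r ≠ c' r := hr
      cases h : c r <;> cases h' : c' r
      · simp [h, h'] at hr'
      · exact key_step m Q B hB hL c' c r h' h (fun r' h => (hlt r' h).symm) heq.symm
      · exact key_step m Q B hB hL c c' r h h' hlt heq
      · simp [h, h'] at hr'
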